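/- Assume the matrix norms of S_N^{-1}A(x_i, z_j) and S_N^{-1}B₁(x_i, z_j) are bounded above by a constant M at all grid points, and let h_x ∈ [h₀, β_x). Then there exist a sufficiently small number h̄_z > 0, depending only on h₀, a, b, R, N and the operator L^h, and a constant C > 0 independent of ε and δ, such that the following holds for all h_z ∈ (0, h̄_z) and all ε, δ > 0: if W*^h is a grid vector function with L^h(W*^h)(x_i, z_j) = 0 for all i ≤ N_x − 1, j ≤ N_z − 1 and boundary values F*^h on ∂Ω^h; if G^h and G*^h are grid vector functions with boundary values F^h and F*^h respectively and ‖G^h − G*^h‖_{H¹,h} < δ; and if W^h_{min,ε,δ} is the unique minimizer of J^h_ε over grid vector functions with boundary values F^h; then ‖W^h_{min,ε,δ} − W*^h‖_{L²,h} ≤ C (δ + √ε ‖W*^h‖_{H¹,h}). -/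

import Mathlib

/-- A grid vector function: to each grid point (i, j) it assigns a vector in ℝ^N. -/
abbrev GridFun (Nx Nz N : ℕ) := Fin Nx → Fin Nz → Fin N → ℝ

/-- (i, j) is a boundary grid point of the grid. -/
def IsBdry {Nx Nz : ℕ} (i : Fin Nx) (j : Fin Nz) : Prop :=
  (i : ℕ) = 0 ∨ (i : ℕ) = Nx - 1 ∨ (j : ℕ) = 0 ∨ (j : ℕ) = Nz - 1

/-- W has boundary values F on ∂Ω^h. -/
def BdryEq {Nx Nz N : ℕ} (W F : GridFun Nx Nz N) : Prop :=
  ∀ i j, IsBdry i j → W i j = F i j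

/-- Squared Euclidean norm on ℝ^N. -/
def euclSq {N : ℕ} (v : Fin N → ℝ) : ℝ := ∑ k, v k ^ 2

/-- Euclidean inner product on ℝ^N. -/
def euclInner {N : ℕ} (v w : Fin N → ℝ) : ℝ := ∑ k, v k * w k

/-- The discrete operator
L^h(W)(x_i,z_j) = ∂_z^{h_z} W + S_N⁻¹ B₁ ∂_x^{h_x} W + S_N⁻¹ A W, for i ≤ N_x−1, j ≤ N_z−1,
with forward finite differences. `Sinv` stands for S_N⁻¹. -/
noncomputable def Lop {Nx Nz N : ℕ} (hx hz : ℝ) (Sinv : Matrix (Fin N) (Fin N) ℝ)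
    (A B : Fin Nx → Fin Nz → Matrix (Fin N) (Fin N) ℝ)
    (W : GridFun Nx Nz N) (i : Fin (Nx - 1)) (j : Fin (Nz - 1)) : Fin N → ℝ :=
  (fun k => (W ⟨i.1, by have := i.isLt; omega⟩ ⟨j.1 + 1, by have := j.isLt; omega⟩ k
      - W ⟨i.1, by have := i.isLt; omega⟩ ⟨j.1, by have := j.isLt; omega⟩ k) / hz)
  + (Sinv * B ⟨i.1, by have := i.isLt; omega⟩ ⟨j.1, by have := j.isLt; omega⟩).mulVec
      (fun k => (W ⟨i.1 + 1, by have := i.isLt; omega⟩ ⟨j.1, by have := j.isLt; omega⟩ k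
        - W ⟨i.1, by have := i.isLt; omega⟩ ⟨j.1, by have := j.isLt; omega⟩ k) / hx)
  + (Sinv * A ⟨i.1, by have := i.isLt; omega⟩ ⟨j.1, by have := j.isLt; omega⟩).mulVec
      (W ⟨i.1, by have := i.isLt; omega⟩ ⟨j.1, by have := j.isLt; omega⟩)

/-- Squared discrete L² norm: ‖W‖²_{L²,h} = h_x h_z Σ_{i,j} |W(x_i,z_j)|². -/
def normL2sq {Nx Nz N : ℕ} (hx hz : ℝ) (W : GridFun Nx Nz N) : ℝ :=
  hx * hz * ∑ i, ∑ j, euclSq (W i j)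

/-- Squared discrete H¹ norm:
‖W‖²_{H¹,h} = ‖W‖²_{L²,h} + h_x h_z Σ_{i ≤ Nx−1, j ≤ Nz−1} (|∂_x W|² + |∂_z W|²). -/
noncomputable def normH1sq {Nx Nz N : ℕ} (hx hz : ℝ) (W : GridFun Nx Nz N) : ℝ :=
  normL2sq hx hz W + hx * hz * ∑ i : Fin (Nx - 1), ∑ j : Fin (Nz - 1),
    (euclSq (fun k => (W ⟨i.1 + 1, by have := i.isLt; omega⟩ ⟨j.1, by have := j.isLt; omega⟩ k
        - W ⟨i.1, by have := i.isLt; omega⟩ ⟨j.1, by have := j.isLt; omega⟩ k) / hx)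
      + euclSq (fun k => (W ⟨i.1, by have := i.isLt; omega⟩ ⟨j.1 + 1, by have := j.isLt; omega⟩ k
        - W ⟨i.1, by have := i.isLt; omega⟩ ⟨j.1, by have := j.isLt; omega⟩ k) / hz))

/-- The discrete Tikhonov-like functional
J^h_ε(W) = h_x h_z Σ_{i ≤ Nx−1, j ≤ Nz−1} |L^h(W)(x_i,z_j)|² + ε ‖W‖²_{H¹,h}. -/
noncomputable def Jfun {Nx Nz N : ℕ} (hx hz ε : ℝ) (Sinv : Matrix (Fin N) (Fin N) ℝ)
    (A B : Fin Nx → Fin Nz → Matrix (Fin N) (Fin N) ℝ) (W : GridFun Nx Nz N) : ℝ :=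
  hx * hz * (∑ i : Fin (Nx - 1), ∑ j : Fin (Nz - 1), euclSq (Lop hx hz Sinv A B W i j))
    + ε * normH1sq hx hz W


lemma euclSq_nonneg' {N : ℕ} (v : Fin N → ℝ) : 0 ≤ euclSq v :=
  Finset.sum_nonneg fun _ _ => sq_nonneg _

lemma euclSq_add_le {N : ℕ} (v w : Fin N → ℝ) :
    euclSq (v + w) ≤ 2 * euclSq v + 2 * euclSq w := by
  unfold euclSq
  rw [Finset.mul_sum, Finset.mul_sum, ← Finset.sum_add_distrib]
  refine Finset.sum_le_sum fun k _ => ?_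
  simp only [Pi.add_apply]
  nlinarith [sq_nonneg (v k - w k)]

lemma euclSq_sub_le {N : ℕ} (v w : Fin N → ℝ) :
    euclSq (v - w) ≤ 2 * euclSq v + 2 * euclSq w := by
  unfold euclSq
  rw [Finset.mul_sum, Finset.mul_sum, ← Finset.sum_add_distrib]
  refine Finset.sum_le_sum fun k _ => ?_
  simp only [Pi.sub_apply]
  nlinarith [sq_nonneg (v k + w k)]

lemma euclSq_div {N : ℕ} (v : Fin N → ℝ) (h : ℝ) :
    euclSq (fun k => v k / h) = euclSq v / h ^ 2 := by
  unfold euclSq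
  rw [Finset.sum_div]
  exact Finset.sum_congr rfl fun k _ => div_pow _ _ _

lemma euclSq_smul' {N : ℕ} (v : Fin N → ℝ) (h : ℝ) :
    euclSq (h • v) = h ^ 2 * euclSq v := by
  unfold euclSq
  rw [Finset.mul_sum]
  exact Finset.sum_congr rfl fun k _ => by simp [mul_pow]

lemma Lop_add' {Nx Nz N : ℕ} (hx hz : ℝ) (Sinv : Matrix (Fin N) (Fin N) ℝ)
    (A B : Fin Nx → Fin Nz → Matrix (Fin N) (Fin N) ℝ)
    (V W : GridFun Nx Nz N) (i : Fin (Nx - 1)) (j : Fin (Nz - 1)) :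
    Lop hx hz Sinv A B (V + W) i j = Lop hx hz Sinv A B V i j + Lop hx hz Sinv A B W i j := by
  ext k
  simp only [Lop, Matrix.mulVec, dotProduct, Pi.add_apply]
  have e1 : ∀ (C : Fin N → ℝ) (p q r s : Fin N → ℝ), ∑ x, C x * ((p x + q x - (r x + s x)) / hx)
      = ∑ x, C x * ((p x - r x) / hx) + ∑ x, C x * ((q x - s x) / hx) := by
    intro C p q r s
    rw [← Finset.sum_add_distrib]
    exact Finset.sum_congr rfl fun x _ => by ring
  have e2 : ∀ (C : Fin N → ℝ) (p q : Fin N → ℝ), ∑ x, C x * (p x + q x)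
      = ∑ x, C x * p x + ∑ x, C x * q x := by
    intro C p q
    rw [← Finset.sum_add_distrib]
    exact Finset.sum_congr rfl fun x _ => by ring
  rw [e1, e2]
  ring

lemma normL2sq_nonneg {Nx Nz N : ℕ} {hx hz : ℝ} (h1 : 0 < hx) (h2 : 0 < hz)
    (W : GridFun Nx Nz N) : 0 ≤ normL2sq hx hz W := by
  unfold normL2sq
  exact mul_nonneg (by positivity) (Finset.sum_nonneg fun _ _ => Finset.sum_nonneg fun _ _ =>
    euclSq_nonneg' _)

lemma normL2sq_le_H1 {Nx Nz N : ℕ} {hx hz : ℝ} (h1 : 0 < hx) (h2 : 0 < hz)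
    (W : GridFun Nx Nz N) : normL2sq hx hz W ≤ normH1sq hx hz W := by
  unfold normH1sq
  refine le_add_of_nonneg_right ?_
  exact mul_nonneg (by positivity) (Finset.sum_nonneg fun _ _ => Finset.sum_nonneg fun _ _ =>
    add_nonneg (euclSq_nonneg' _) (euclSq_nonneg' _))

lemma sum2_le {m n : ℕ} (f g h : Fin m → Fin n → ℝ) (H : ∀ i j, f i j ≤ 2 * g i j + 2 * h i j) :
    ∑ i, ∑ j, f i j ≤ 2 * ∑ i, ∑ j, g i j + 2 * ∑ i, ∑ j, h i j := by
  simp only [Finset.mul_sum, ← Finset.sum_add_distrib]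
  exact Finset.sum_le_sum fun i _ => Finset.sum_le_sum fun j _ => H i j

lemma sum4_le {m n : ℕ} (f a b c d : Fin m → Fin n → ℝ)
    (H : ∀ i j, f i j ≤ (2 * a i j + 2 * b i j) + (2 * c i j + 2 * d i j)) :
    ∑ i, ∑ j, f i j ≤ 2 * ∑ i, ∑ j, (a i j + c i j) + 2 * ∑ i, ∑ j, (b i j + d i j) :=
  sum2_le _ _ _ fun i j => (H i j).trans (le_of_eq (by ring))

lemma normL2sq_add_le {Nx Nz N : ℕ} {hx hz : ℝ} (h1 : 0 < hx) (h2 : 0 < hz)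
    (V W : GridFun Nx Nz N) :
    normL2sq hx hz (V + W) ≤ 2 * normL2sq hx hz V + 2 * normL2sq hx hz W := by
  unfold normL2sq
  have := sum2_le _ _ _ (fun i j => euclSq_add_le (V i j) (W i j))
  have := mul_le_mul_of_nonneg_left this (mul_pos h1 h2).le
  simp only [Pi.add_apply]
  linarith

lemma normL2sq_sub_le {Nx Nz N : ℕ} {hx hz : ℝ} (h1 : 0 < hx) (h2 : 0 < hz)
    (V W : GridFun Nx Nz N) :
    normL2sq hx hz (V - W) ≤ 2 * normL2sq hx hz V + 2 * normL2sq hx hz W := by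
  unfold normL2sq
  have := sum2_le _ _ _ (fun i j => euclSq_sub_le (V i j) (W i j))
  have := mul_le_mul_of_nonneg_left this (mul_pos h1 h2).le
  simp only [Pi.sub_apply]
  linarith

lemma euclSq_diff_add {N : ℕ} (p q r s : Fin N → ℝ) (h : ℝ) :
    euclSq (fun k => (p k + q k - (r k + s k)) / h) ≤
      2 * euclSq (fun k => (p k - r k) / h) + 2 * euclSq (fun k => (q k - s k) / h) := by
  refine le_trans (le_of_eq ?_) (euclSq_add_le _ _)
  congr 1
  ext k
  simp only [Pi.add_apply]
  ring

lemma normH1sq_add_le {Nx Nz N : ℕ} {hx hz : ℝ} (h1 : 0 < hx) (h2 : 0 < hz)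
    (V W : GridFun Nx Nz N) :
    normH1sq hx hz (V + W) ≤ 2 * normH1sq hx hz V + 2 * normH1sq hx hz W := by
  have h0 := normL2sq_add_le h1 h2 V W
  unfold normH1sq
  simp only [Pi.add_apply]
  have h3 := mul_le_mul_of_nonneg_left
    (sum4_le (m := Nx - 1) (n := Nz - 1) _ _ _ _ _ (fun i j =>
    (add_le_add (euclSq_diff_add (V ⟨i.1 + 1, by omega⟩ ⟨j.1, by omega⟩)
      (W ⟨i.1 + 1, by omega⟩ ⟨j.1, by omega⟩) (V ⟨i.1, by omega⟩ ⟨j.1, by omega⟩)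
      (W ⟨i.1, by omega⟩ ⟨j.1, by omega⟩) hx)
     (euclSq_diff_add (V ⟨i.1, by omega⟩ ⟨j.1 + 1, by omega⟩)
      (W ⟨i.1, by omega⟩ ⟨j.1 + 1, by omega⟩) (V ⟨i.1, by omega⟩ ⟨j.1, by omega⟩)
      (W ⟨i.1, by omega⟩ ⟨j.1, by omega⟩) hz)))) (mul_pos h1 h2).le
  refine le_trans (add_le_add h0 h3) (le_of_eq (by ring))

/-- residual -/
noncomputable def Tres {Nx Nz N : ℕ} (hx hz : ℝ) (Sinv : Matrix (Fin N) (Fin N) ℝ)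
    (A B : Fin Nx → Fin Nz → Matrix (Fin N) (Fin N) ℝ) (W : GridFun Nx Nz N) : ℝ :=
  ∑ i : Fin (Nx - 1), ∑ j : Fin (Nz - 1), euclSq (Lop hx hz Sinv A B W i j)

lemma Tres_nonneg {Nx Nz N : ℕ} (hx hz : ℝ) (Sinv : Matrix (Fin N) (Fin N) ℝ)
    (A B : Fin Nx → Fin Nz → Matrix (Fin N) (Fin N) ℝ) (W : GridFun Nx Nz N) :
    0 ≤ Tres hx hz Sinv A B W :=
  Finset.sum_nonneg fun _ _ => Finset.sum_nonneg fun _ _ => euclSq_nonneg' _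

lemma le_sum2 {m n : ℕ} (f : Fin m → Fin n → ℝ) (hf : ∀ i j, 0 ≤ f i j) (i : Fin m) (j : Fin n) :
    f i j ≤ ∑ i, ∑ j, f i j :=
  le_trans (Finset.single_le_sum (f := fun j => f i j) (fun j _ => hf i j) (Finset.mem_univ j))
    (Finset.single_le_sum (f := fun i => ∑ j, f i j)
      (fun i _ => Finset.sum_nonneg fun j _ => hf i j) (Finset.mem_univ i))

lemma Tres_le {Nx Nz N : ℕ} {hx hz : ℝ} (h1 : 0 < hx) (h2 : 0 < hz)
    (Sinv : Matrix (Fin N) (Fin N) ℝ)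
    (A B : Fin Nx → Fin Nz → Matrix (Fin N) (Fin N) ℝ) (M : ℝ)
    (hMA : ∀ i j (v : Fin N → ℝ), euclSq ((Sinv * A i j).mulVec v) ≤ M ^ 2 * euclSq v)
    (hMB : ∀ i j (v : Fin N → ℝ), euclSq ((Sinv * B i j).mulVec v) ≤ M ^ 2 * euclSq v)
    (W : GridFun Nx Nz N) :
    hx * hz * Tres hx hz Sinv A B W ≤
      (4 + 4 * M ^ 2 + 2 * M ^ 2 * ((Nx - 1 : ℕ) * (Nz - 1 : ℕ))) * normH1sq hx hz W := by
  set P : ℝ := ∑ i, ∑ j, euclSq (W i j) with hP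
  have hP0 : 0 ≤ P := Finset.sum_nonneg fun _ _ => Finset.sum_nonneg fun _ _ => euclSq_nonneg' _
  set Q : ℝ := ∑ i : Fin (Nx - 1), ∑ j : Fin (Nz - 1),
    (euclSq (fun k => (W ⟨i.1 + 1, by have := i.isLt; omega⟩ ⟨j.1, by have := j.isLt; omega⟩ k
        - W ⟨i.1, by have := i.isLt; omega⟩ ⟨j.1, by have := j.isLt; omega⟩ k) / hx)
      + euclSq (fun k => (W ⟨i.1, by have := i.isLt; omega⟩ ⟨j.1 + 1, by have := j.isLt; omega⟩ k
        - W ⟨i.1, by have := i.isLt; omega⟩ ⟨j.1, by have := j.isLt; omega⟩ k) / hz)) with hQ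
  have hQ0 : 0 ≤ Q := Finset.sum_nonneg fun _ _ => Finset.sum_nonneg fun _ _ =>
    add_nonneg (euclSq_nonneg' _) (euclSq_nonneg' _)
  have hn : normH1sq hx hz W = hx * hz * (P + Q) := by
    unfold normH1sq normL2sq; rw [← hP, ← hQ]; ring
  have hT : Tres hx hz Sinv A B W ≤ (4 + 4 * M ^ 2) * Q
      + (Nx - 1 : ℕ) * ((Nz - 1 : ℕ) * (2 * M ^ 2 * P)) := by
    have : (Nx - 1 : ℕ) * ((Nz - 1 : ℕ) * (2 * M ^ 2 * P)) =
      ∑ i : Fin (Nx - 1), ∑ j : Fin (Nz - 1), 2 * M ^ 2 * P := by simp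
    rw [this, hQ]
    simp only [Finset.mul_sum, ← Finset.sum_add_distrib]
    unfold Tres
    refine Finset.sum_le_sum fun i _ => Finset.sum_le_sum fun j _ => ?_
    unfold Lop
    refine (euclSq_add_le _ _).trans ?_
    have a1 := hMA ⟨i.1, by have := i.isLt; omega⟩ ⟨j.1, by have := j.isLt; omega⟩
      (W ⟨i.1, by have := i.isLt; omega⟩ ⟨j.1, by have := j.isLt; omega⟩)
    have a2 := hMB ⟨i.1, by have := i.isLt; omega⟩ ⟨j.1, by have := j.isLt; omega⟩
      (fun k => (W ⟨i.1 + 1, by have := i.isLt; omega⟩ ⟨j.1, by have := j.isLt; omega⟩ k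
        - W ⟨i.1, by have := i.isLt; omega⟩ ⟨j.1, by have := j.isLt; omega⟩ k) / hx)
    have a3 := le_sum2 (fun i j => euclSq (W i j)) (fun i j => euclSq_nonneg' _)
      ⟨i.1, by have := i.isLt; omega⟩ ⟨j.1, by have := j.isLt; omega⟩
    rw [← hP] at a3
    have a4 := mul_le_mul_of_nonneg_left a3 (sq_nonneg M)
    refine (add_le_add (mul_le_mul_of_nonneg_left (euclSq_add_le _ _) zero_le_two)
      (mul_le_mul_of_nonneg_left a1 zero_le_two)).trans ?_
    generalize hX : euclSq (fun k => (W ⟨i.1 + 1, by have := i.isLt; omega⟩ ⟨j.1, by have := j.isLt; omega⟩ k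
        - W ⟨i.1, by have := i.isLt; omega⟩ ⟨j.1, by have := j.isLt; omega⟩ k) / hx) = X at *
    generalize hY : euclSq (fun k => (W ⟨i.1, by have := i.isLt; omega⟩ ⟨j.1 + 1, by have := j.isLt; omega⟩ k
        - W ⟨i.1, by have := i.isLt; omega⟩ ⟨j.1, by have := j.isLt; omega⟩ k) / hz) = Y at *
    have hX0 : 0 ≤ X := hX ▸ euclSq_nonneg' _
    have hY0 : 0 ≤ Y := hY ▸ euclSq_nonneg' _
    have : 0 ≤ M ^ 2 * Y := by positivity
    linarith
  rw [hn]
  have := mul_le_mul_of_nonneg_left hT (mul_pos h1 h2).le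
  refine this.trans ?_
  rw [mul_left_comm _ (hx * hz) (P + Q)]
  refine mul_le_mul_of_nonneg_left ?_ (mul_pos h1 h2).le
  have b1 : (0:ℝ) ≤ (4 + 4 * M ^ 2) * P := by positivity
  have b2 : (0:ℝ) ≤ 2 * M ^ 2 * ((Nx - 1 : ℕ) * (Nz - 1 : ℕ)) * Q := by positivity
  linarith

/-- marching constant -/
noncomputable def cm (hx M : ℝ) : ℕ → ℝ
  | 0 => 0
  | j + 1 => 2 * (cm hx M j) + 8 * (1 + M ^ 2 * (4 * cm hx M j / hx ^ 2) + M ^ 2 * cm hx M j)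

lemma cm_nonneg (hx M : ℝ) (j : ℕ) : 0 ≤ cm hx M j := by
  induction j with
  | zero => simp [cm]
  | succ j ih => unfold cm; positivity

lemma march {Nx Nz N : ℕ} {hx hz : ℝ} (h1 : 0 < hx) (h2 : 0 < hz) (h3 : hz < 1)
    (Sinv : Matrix (Fin N) (Fin N) ℝ)
    (A B : Fin Nx → Fin Nz → Matrix (Fin N) (Fin N) ℝ) (M : ℝ)
    (hMA : ∀ i j (v : Fin N → ℝ), euclSq ((Sinv * A i j).mulVec v) ≤ M ^ 2 * euclSq v)
    (hMB : ∀ i j (v : Fin N → ℝ), euclSq ((Sinv * B i j).mulVec v) ≤ M ^ 2 * euclSq v)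
    (W : GridFun Nx Nz N) (hW : ∀ i j, IsBdry i j → W i j = 0) (j : ℕ) :
    ∀ (hj : j < Nz) (i : Fin Nx),
      euclSq (W i ⟨j, hj⟩) ≤ cm hx M j * Tres hx hz Sinv A B W := by
  have hT0 := Tres_nonneg hx hz Sinv A B W
  have hz0 : euclSq (0 : Fin N → ℝ) = 0 := by simp [euclSq]
  induction j with
  | zero =>
    intro hj i
    rw [hW i ⟨0, hj⟩ (by simp [IsBdry]), hz0]
    simp [cm]
  | succ j ih =>
    intro hj i
    by_cases hi : i.1 + 1 < Nx
    · have hj' : j < Nz := by omega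
      set p := W i ⟨j, hj'⟩ with hp
      set q := W ⟨i.1 + 1, hi⟩ ⟨j, hj'⟩ with hq
      have ip : euclSq p ≤ _ := ih hj' i
      have iq : euclSq q ≤ _ := ih hj' ⟨i.1 + 1, hi⟩
      have c0 := cm_nonneg hx M j
      set l := Lop hx hz Sinv A B W ⟨i.1, by omega⟩ ⟨j, by omega⟩ with hl
      have il : euclSq l ≤ Tres hx hz Sinv A B W :=
        le_sum2 (fun i j => euclSq (Lop hx hz Sinv A B W i j)) (fun i j => euclSq_nonneg' _) _ _
      set β := (Sinv * B i ⟨j, hj'⟩).mulVec (fun k => (q k - p k) / hx) with hβ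
      set α := (Sinv * A i ⟨j, hj'⟩).mulVec p with hα
      have key : W i ⟨j + 1, hj⟩ = p + hz • ((l - β) - α) := by
        have : l = (fun k => (W i ⟨j + 1, hj⟩ k - p k) / hz) + β + α := rfl
        rw [this]
        ext k
        simp only [Pi.add_apply, Pi.sub_apply, Pi.smul_apply, smul_eq_mul]
        field_simp
        ring
      have ia : euclSq α ≤ M ^ 2 * euclSq p := hMA _ _ _
      have ib : euclSq β ≤ M ^ 2 * (euclSq (q - p) / hx ^ 2) := by
        rw [← euclSq_div]; exact hMB _ _ _
      have iqp := euclSq_sub_le q p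
      set T := Tres hx hz Sinv A B W
      set c := cm hx M j
      have ib2 : euclSq β ≤ M ^ 2 * (4 * (c * T) / hx ^ 2) := by
        refine ib.trans ?_
        have : euclSq (q - p) ≤ 4 * (c * T) := by linarith
        gcongr
      have ia2 : euclSq α ≤ M ^ 2 * (c * T) := ia.trans (by gcongr)
      have s1 := euclSq_sub_le l β
      have s2 := euclSq_sub_le (l - β) α
      have s3 := euclSq_add_le p (hz • ((l - β) - α))
      rw [euclSq_smul'] at s3
      have s4 : hz ^ 2 * euclSq (l - β - α) ≤ euclSq (l - β - α) :=
        mul_le_of_le_one_left (euclSq_nonneg' _) (by nlinarith)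
      rw [key]
      have e : cm hx M (j + 1) * T = 2 * (c * T) + 8 * (T + M ^ 2 * (4 * (c * T) / hx ^ 2)
        + M ^ 2 * (c * T)) := by
        simp only [cm]; ring
      rw [e]
      have := euclSq_nonneg' α
      linarith
    · rw [hW i ⟨j + 1, hj⟩ (by right; left; omega), hz0]
      exact mul_nonneg (cm_nonneg _ _ _) hT0

/-- convergence of regularized solutions: assuming the matrix (operator)
norms of S⁻¹A and S⁻¹B₁ are bounded by M at all grid points and h_x ∈ [h₀, β_x), there
exist h̄_z > 0 (depending only on h₀, a, b, R, N and the operator L^h) and C > 0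
(independent of ε and δ) such that, for all h_z ∈ (0, h̄_z) and all ε, δ > 0: if W*^h
solves L^h(W*^h) = 0 with boundary values F*^h, if G^h, G*^h extend the boundary data F^h,
F*^h with ‖G^h − G*^h‖_{H¹,h} < δ, and if W^h_{min,ε,δ} is the minimizer of J^h_ε with
boundary values F^h, then ‖W^h_{min,ε,δ} − W*^h‖_{L²,h} ≤ C (δ + √ε ‖W*^h‖_{H¹,h}). -/
theorem stmt_12 (N Nx Nz : ℕ) (hN : 1 ≤ N) (hNx : 2 ≤ Nx) (hNz : 2 ≤ Nz)
    (R a b h₀ βx βz : ℝ) (hR : 1 < R) (ha : 0 < a) (hab : a < b)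
    (hh₀ : 0 < h₀) (hβx : 0 < βx) (hβz : 0 < βz)
    (hx : ℝ) (hhx : hx ∈ Set.Ico h₀ βx)
    (S : Matrix (Fin N) (Fin N) ℝ) (hS : IsUnit S.det)
    (A B : Fin Nx → Fin Nz → Matrix (Fin N) (Fin N) ℝ)
    (M : ℝ)
    (hMA : ∀ i j (v : Fin N → ℝ), euclSq ((S⁻¹ * A i j).mulVec v) ≤ M ^ 2 * euclSq v)
    (hMB : ∀ i j (v : Fin N → ℝ), euclSq ((S⁻¹ * B i j).mulVec v) ≤ M ^ 2 * euclSq v) :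
    ∃ hbarz > 0, ∃ C > 0, ∀ hz ∈ Set.Ioo 0 hbarz, ∀ ε > 0, ∀ δ > 0,
      ∀ F Fstar G Gstar Wstar Wmin : GridFun Nx Nz N,
        (∀ (i : Fin (Nx - 1)) (j : Fin (Nz - 1)), Lop hx hz S⁻¹ A B Wstar i j = 0) →
        BdryEq Wstar Fstar →
        BdryEq G F →
        BdryEq Gstar Fstar →
        Real.sqrt (normH1sq hx hz (G - Gstar)) < δ →
        BdryEq Wmin F →
        (∀ V : GridFun Nx Nz N, BdryEq V F →
          Jfun hx hz ε S⁻¹ A B Wmin ≤ Jfun hx hz ε S⁻¹ A B V) →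
        Real.sqrt (normL2sq hx hz (Wmin - Wstar)) ≤
          C * (δ + Real.sqrt ε * Real.sqrt (normH1sq hx hz Wstar)) := by
  have h1 : 0 < hx := lt_of_lt_of_le hh₀ hhx.1
  set K : ℝ := 4 + 4 * M ^ 2 + 2 * M ^ 2 * ((Nx - 1 : ℕ) * (Nz - 1 : ℕ)) with hK
  have hK0 : 0 ≤ K := by positivity
  set c : ℝ := ∑ _i : Fin Nx, ∑ j : Fin Nz, cm hx M j with hc
  have hc0 : 0 ≤ c := Finset.sum_nonneg fun _ _ => Finset.sum_nonneg fun _ _ => cm_nonneg _ _ _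
  set C : ℝ := 2 * (c * (4 * K + 4)) + 2 * K + 10 with hC
  have hC0 : 0 < C := by positivity
  refine ⟨1, one_pos, Real.sqrt C, Real.sqrt_pos.2 hC0, ?_⟩
  rintro hz ⟨h2, h3⟩ ε hε δ hδ F Fs G Gs Ws Wm hL hWs hG hGs hd hWm hmin
  set D := G - Gs with hD
  set d := normH1sq hx hz D with hdd
  set w := normH1sq hx hz Ws with hw
  have hd0 : 0 ≤ d := (normL2sq_nonneg h1 h2 _).trans (normL2sq_le_H1 h1 h2 D)
  have hw0 : 0 ≤ w := (normL2sq_nonneg h1 h2 _).trans (normL2sq_le_H1 h1 h2 Ws)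
  have hm0 : 0 ≤ normH1sq hx hz Wm := (normL2sq_nonneg h1 h2 _).trans (normL2sq_le_H1 h1 h2 Wm)
  have hmn := hmin (Ws + D) (by
    intro i j hij
    simp only [hD, Pi.add_apply, Pi.sub_apply, hWs i j hij, hG i j hij, hGs i j hij]
    abel)
  have hLV : ∀ i j, Lop hx hz S⁻¹ A B (Ws + D) i j = Lop hx hz S⁻¹ A B D i j := by
    intro i j; rw [Lop_add', hL, zero_add]
  unfold Jfun at hmn
  simp only [hLV] at hmn
  change hx * hz * Tres hx hz S⁻¹ A B Wm + _ ≤ hx * hz * Tres hx hz S⁻¹ A B D + _ at hmn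
  have hTD := Tres_le h1 h2 S⁻¹ A B M hMA hMB D
  rw [← hK, ← hdd] at hTD
  have hadd := normH1sq_add_le h1 h2 Ws D
  rw [← hw, ← hdd] at hadd
  have hadd' := mul_le_mul_of_nonneg_left hadd hε.le
  set t := hx * hz * Tres hx hz S⁻¹ A B Wm with ht
  have ht0 : 0 ≤ t := mul_nonneg (mul_pos h1 h2).le (Tres_nonneg _ _ _ _ _ _)
  have hεw : 0 ≤ ε * w := by positivity
  have main : normL2sq hx hz (Wm - Ws) ≤ C * (d + ε * w) := by
    have hcK : 0 ≤ c * (4 * K + 4) := by positivity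
    by_cases hε1 : ε ≤ 1
    · set Q := Wm - Ws - D with hQ
      have hQ0 : ∀ i j, IsBdry i j → Q i j = 0 := by
        intro i j hij
        simp only [hQ, hD, Pi.sub_apply, hWs i j hij, hG i j hij, hGs i j hij, hWm i j hij]
        abel
      have hLQ : ∀ i j, Lop hx hz S⁻¹ A B Q i j
          = Lop hx hz S⁻¹ A B Wm i j - Lop hx hz S⁻¹ A B D i j := by
        intro i j
        have : Wm = Q + (Ws + D) := by rw [hQ]; abel
        rw [eq_sub_iff_add_eq]
        conv_rhs => rw [this, Lop_add', hLV]
      have hTQ : Tres hx hz S⁻¹ A B Q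
          ≤ 2 * Tres hx hz S⁻¹ A B Wm + 2 * Tres hx hz S⁻¹ A B D := by
        unfold Tres
        refine sum2_le _ _ _ fun i j => ?_
        rw [hLQ]; exact euclSq_sub_le _ _
      have hQn : normL2sq hx hz Q ≤ c * (hx * hz * Tres hx hz S⁻¹ A B Q) := by
        unfold normL2sq
        rw [mul_left_comm]
        refine mul_le_mul_of_nonneg_left ?_ (mul_pos h1 h2).le
        rw [hc, Finset.sum_mul]
        refine Finset.sum_le_sum fun i _ => ?_
        rw [Finset.sum_mul]
        exact Finset.sum_le_sum fun j _ => march h1 h2 h3 S⁻¹ A B M hMA hMB Q hQ0 j.1 j.2 i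
      have hTQ' := mul_le_mul_of_nonneg_left hTQ (mul_pos h1 h2).le
      have hεd : ε * d ≤ d := mul_le_of_le_one_left hd0 hε1
      have hεm : 0 ≤ ε * normH1sq hx hz Wm := by positivity
      have hb : hx * hz * Tres hx hz S⁻¹ A B Q ≤ (4 * K + 4) * (d + ε * w) := by
        have : 0 ≤ K * (ε * w) := by positivity
        linarith
      have hb' := mul_le_mul_of_nonneg_left hb hc0
      have hfin := normL2sq_add_le h1 h2 Q D
      have hDn := normL2sq_le_H1 h1 h2 D
      have : Wm - Ws = Q + D := by rw [hQ]; abel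
      rw [this]
      have : 0 ≤ K * (d + ε * w) := by positivity
      rw [hC]
      linarith
    · have hε1 : 1 ≤ ε := (not_le.1 hε1).le
      have hKd : K * d ≤ ε * (K * d) := le_mul_of_one_le_left (by positivity) hε1
      have hwε : w ≤ ε * w := le_mul_of_one_le_left hw0 hε1
      have hm : normH1sq hx hz Wm ≤ K * d + 2 * w + 2 * d := by
        refine le_of_mul_le_mul_left ?_ hε
        linarith
      have hfin := normL2sq_sub_le h1 h2 Wm Ws
      have hDn := normL2sq_le_H1 h1 h2 Wm
      have hDs := normL2sq_le_H1 h1 h2 Ws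
      have : 0 ≤ K * (ε * w) := by positivity
      have : 0 ≤ c * (4 * K + 4) * (d + ε * w) := by positivity
      rw [hC]
      linarith
  have hdδ : d ≤ δ ^ 2 := (Real.sqrt_le_left hδ.le).1 hd.le
  have : d + ε * w ≤ (δ + Real.sqrt ε * Real.sqrt w) ^ 2 := by
    have e1 : (Real.sqrt ε * Real.sqrt w) ^ 2 = ε * w := by
      rw [mul_pow, Real.sq_sqrt hε.le, Real.sq_sqrt hw0]
    have e2 : 0 ≤ δ * (Real.sqrt ε * Real.sqrt w) := by positivity
    nlinarith
  calc Real.sqrt (normL2sq hx hz (Wm - Ws))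
      ≤ Real.sqrt (C * (δ + Real.sqrt ε * Real.sqrt w) ^ 2) :=
        Real.sqrt_le_sqrt (main.trans (mul_le_mul_of_nonneg_left this hC0.le))
    _ = _ := by rw [Real.sqrt_mul hC0.le, Real.sqrt_sq (by positivity)]
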